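/- For a connected finite simple graph G, the largest eigenvalue of the Laplacian L(G) equals the largest eigenvalue of the signless Laplacian Q(G) if and only if G is bipartite. -/

import Mathlib

open Matrix

namespace Matrix.IsHermitian

variable {n : Type*} [Fintype n] [DecidableEq n] {A : Matrix n n ℝ}

theorem posSemidef_iSup_eigenvalues_sub (hA : A.IsHermitian) :
    (algebraMap ℝ (Matrix n n ℝ) (⨆ i, hA.eigenvalues i) - A).PosSemidef := by
  rw [posSemidef_iff_isHermitian_and_spectrum_nonneg]
  refine ⟨?_, ?_⟩
  · rw [algebraMap_eq_diagonal]
    exact (isHermitian_diagonal _).sub hA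
  · rw [← spectrum.singleton_sub_eq, hA.spectrum_real_eq_range_eigenvalues]
    rintro _ ⟨_, rfl, _, ⟨i, rfl⟩, rfl⟩
    exact sub_nonneg.2 (le_ciSup (Set.finite_range hA.eigenvalues).bddAbove i)

theorem exists_mulVec_eq_iSup_eigenvalues_smul [Nonempty n] (hA : A.IsHermitian) :
    ∃ x : n → ℝ, x ≠ 0 ∧ A *ᵥ x = (⨆ i, hA.eigenvalues i) • x := by
  obtain ⟨i, hi⟩ := exists_eq_ciSup_of_finite (f := hA.eigenvalues)
  refine ⟨hA.eigenvectorBasis i, fun h ↦ hA.eigenvectorBasis.orthonormal.ne_zero i ?_, ?_⟩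
  · ext j
    exact congrFun h j
  · rw [← hi, hA.mulVec_eigenvectorBasis]

/-- A nonnegative vector `y` with `(⨆ i, hA.eigenvalues i) • y ≤ A *ᵥ y` is an eigenvector. -/
theorem mulVec_eq_of_iSup_eigenvalues_smul_le (hA : A.IsHermitian) {y : n → ℝ} (hy : 0 ≤ y)
    (h : (⨆ i, hA.eigenvalues i) • y ≤ A *ᵥ y) : A *ᵥ y = (⨆ i, hA.eigenvalues i) • y := by
  have hpos := hA.posSemidef_iSup_eigenvalues_sub
  have hmul : (algebraMap ℝ (Matrix n n ℝ) (⨆ i, hA.eigenvalues i) - A) *ᵥ y =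
      (⨆ i, hA.eigenvalues i) • y - A *ᵥ y := by
    rw [sub_mulVec, Algebra.algebraMap_eq_smul_one, smul_mulVec, one_mulVec]
  have hzero := (hpos.dotProduct_mulVec_zero_iff y).1 <| le_antisymm
    (by
      rw [hmul]
      exact Finset.sum_nonpos fun i _ ↦
        mul_nonpos_of_nonneg_of_nonpos (hy i) (sub_nonpos.2 (h i)))
    (hpos.dotProduct_mulVec_nonneg y)
  rw [hmul] at hzero
  exact (sub_eq_zero.1 hzero).symm

end Matrix.IsHermitian

namespace SimpleGraph

variable {V : Type*} [Fintype V] [DecidableEq V] {G : SimpleGraph V} [DecidableRel G.Adj]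

theorem degMatrix_add_adjMatrix_mulVec_apply (x : V → ℝ) (v : V) :
    ((G.degMatrix ℝ + G.adjMatrix ℝ) *ᵥ x) v =
      G.degree v * x v + ∑ u ∈ G.neighborFinset v, x u := by
  rw [add_mulVec, Pi.add_apply, degMatrix_mulVec_apply, adjMatrix_mulVec_apply]

theorem charpoly_lapMatrix_eq_of_colorable_two (h : G.Colorable 2) :
    (G.lapMatrix ℝ).charpoly = (G.degMatrix ℝ + G.adjMatrix ℝ).charpoly := by
  obtain ⟨c⟩ := h
  let s : V → ℝ := fun v ↦ if c v = 0 then 1 else -1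
  have hs (v : V) : s v * s v = 1 := by simp only [s]; split_ifs <;> norm_num
  have hadj {v w : V} (hvw : G.Adj v w) : s v * s w = -1 := by
    have := c.valid hvw
    simp only [s]
    split_ifs <;> grind
  have hss : diagonal s * diagonal s = 1 := by
    rw [diagonal_mul_diagonal, ← diagonal_one]
    exact congrArg diagonal (funext hs)
  let S : (Matrix V V ℝ)ˣ := ⟨diagonal s, diagonal s, hss, hss⟩
  have hconj : S.val * G.lapMatrix ℝ * S⁻¹.val = G.degMatrix ℝ + G.adjMatrix ℝ := by
    ext v w
    change (diagonal s * G.lapMatrix ℝ * diagonal s) v w = _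
    rw [mul_diagonal, diagonal_mul, lapMatrix, Matrix.sub_apply, Matrix.add_apply, degMatrix,
      adjMatrix_apply]
    by_cases hvw : v = w
    · subst hvw
      simp only [diagonal_apply_eq, G.irrefl, if_false]
      linear_combination (G.degree v : ℝ) * hs v
    · rw [diagonal_apply_ne _ hvw]
      split_ifs with h
      · linear_combination -hadj h
      · ring
  rw [← hconj, coe_units_inv, charpoly_units_conj]

theorem Connected.pos_of_mulVec_eq_smul (hconn : G.Connected) {y : V → ℝ} (hy : 0 ≤ y)
    (hy0 : y ≠ 0) {r : ℝ} (h : (G.degMatrix ℝ + G.adjMatrix ℝ) *ᵥ y = r • y) (v : V) :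
    0 < y v := by
  have hstep {v w : V} (hvw : G.Adj v w) (hv : y v = 0) : y w = 0 := by
    have hsum := congrFun h v
    rw [degMatrix_add_adjMatrix_mulVec_apply, Pi.smul_apply, hv, smul_zero, mul_zero, zero_add,
      Finset.sum_eq_zero_iff_of_nonneg fun u _ ↦ hy u] at hsum
    exact hsum w (by simpa using hvw)
  have hwalk {v w : V} (p : G.Walk v w) : y v = 0 → y w = 0 := by
    induction p with
    | nil => exact id
    | cons hadj _ ih => exact fun hv ↦ ih (hstep hadj hv)
  refine (hy v).lt_of_ne fun hv ↦ hy0 (funext fun w ↦ ?_)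
  obtain ⟨p⟩ := hconn.preconnected v w
  exact hwalk p hv.symm

theorem Connected.colorable_two_of_iSup_eigenvalues_eq (hconn : G.Connected)
    (hL : (G.lapMatrix ℝ).IsHermitian) (hQ : (G.degMatrix ℝ + G.adjMatrix ℝ).IsHermitian)
    (h : (⨆ i, hL.eigenvalues i) = ⨆ i, hQ.eigenvalues i) : G.Colorable 2 := by
  have := hconn.nonempty
  obtain ⟨x, hx0, hx⟩ := hL.exists_mulVec_eq_iSup_eigenvalues_smul
  rw [h] at hx
  have hxv (v : V) := congrFun hx v
  simp only [lapMatrix_mulVec_apply, Pi.smul_apply, smul_eq_mul] at hxv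
  let s : V → ℝ := fun v ↦ if 0 ≤ x v then 1 else -1
  have hs (v : V) : s v * x v = |x v| := by
    simp only [s]
    split_ifs with hv
    · rw [one_mul, abs_of_nonneg hv]
    · rw [neg_one_mul, abs_of_neg (not_le.1 hv)]
  have hle (v u : V) : -(s v * x u) ≤ |x u| := by
    simp only [s]
    split_ifs
    · simpa using neg_le_abs (x u)
    · simpa using le_abs_self (x u)
  have hlap (v : V) : (⨆ i, hQ.eigenvalues i) * |x v| =
      G.degree v * |x v| + ∑ u ∈ G.neighborFinset v, -(s v * x u) := by
    rw [Finset.sum_neg_distrib, ← Finset.mul_sum, ← hs]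
    linear_combination -s v * hxv v
  have hy : (0 : V → ℝ) ≤ fun v ↦ |x v| := fun v ↦ abs_nonneg _
  have hQy := hQ.mulVec_eq_of_iSup_eigenvalues_smul_le hy fun v ↦ by
    rw [degMatrix_add_adjMatrix_mulVec_apply, Pi.smul_apply, smul_eq_mul, hlap]
    gcongr with u
    exact hle v u
  have hpos := hconn.pos_of_mulVec_eq_smul hy
    (fun h0 ↦ hx0 (funext fun v ↦ abs_eq_zero.1 (congrFun h0 v))) hQy
  have hopp {v u : V} (hvu : G.Adj v u) : -(s v * x u) = |x u| := by
    have hv := congrFun hQy v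
    rw [degMatrix_add_adjMatrix_mulVec_apply, Pi.smul_apply, smul_eq_mul, hlap] at hv
    exact (Finset.sum_eq_sum_iff_of_le fun u _ ↦ hle v u).1 (add_left_cancel hv).symm u
      (by simpa using hvu)
  refine (Coloring.mk (fun v ↦ decide (0 ≤ x v)) fun {v u} hvu heq ↦ ?_ : G.Coloring Bool).colorable
  have hsvu : s v = s u := by
    simp only [s, decide_eq_decide.1 heq]
  have := hopp hvu
  rw [hsvu, hs] at this
  have := hpos u
  linarith

end SimpleGraph

/-- For a connected finite simple graph `G` on at least two vertices, the largest
eigenvalue of the Laplacian equals the largest eigenvalue of the signless Laplacian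
if and only if `G` is bipartite. -/
theorem stmt7 {V : Type*} [Fintype V] [DecidableEq V]
    (G : SimpleGraph V) [DecidableRel G.Adj]
    (hconn : G.Connected) (hcard : 1 < Fintype.card V)
    (hL : (G.lapMatrix ℝ).IsHermitian)
    (hQ : (G.degMatrix ℝ + G.adjMatrix ℝ).IsHermitian) :
    (⨆ i, hL.eigenvalues i) = (⨆ i, hQ.eigenvalues i) ↔ G.Colorable 2 := by
  refine ⟨hconn.colorable_two_of_iSup_eigenvalues_eq hL hQ, fun h ↦ ?_⟩
  rw [(hL.eigenvalues_eq_eigenvalues_iff hQ).2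
    (SimpleGraph.charpoly_lapMatrix_eq_of_colorable_two h)]
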